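/- Let k be a field, V a k-vector space with a bilinear pairing, and A, B ⊆ V subspaces with A = A^⊥ and B = B^⊥ such that A/(A∩B) is finite-dimensional. Then the induced map B/(A∩B) → (A/(A∩B))^* is an isomorphism; in particular dim B/(A∩B) = dim A/(A∩B). -/

import Mathlib

/-- Orthogonal complement of a subspace with respect to a bilinear pairing. -/
def gorth {k V : Type*} [Field k] [AddCommGroup V] [Module k V]
    (Bl : V →ₗ[k] V →ₗ[k] k) (W : Submodule k V) : Submodule k V where
  carrier := {v | ∀ w ∈ W, Bl v w = 0}
  add_mem' := by intro a b ha hb w hw; simp [ha w hw, hb w hw]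
  zero_mem' := by intro w hw; simp
  smul_mem' := by intro c a ha w hw; simp [ha w hw]

theorem aux_pair {k V : Type*} [Field k] [AddCommGroup V] [Module k V]
    (C : V →ₗ[k] V →ₗ[k] k) (A B : Submodule k V)
    (h1 : ∀ b ∈ A ⊓ B, ∀ a ∈ A, C b a = 0)
    (h2 : ∀ a ∈ A ⊓ B, ∀ b ∈ B, C b a = 0) :
    ∃ φ : (↥B ⧸ (A ⊓ B).comap B.subtype) →ₗ[k]
        Module.Dual k (↥A ⧸ (A ⊓ B).comap A.subtype),
      ∀ (b : ↥B) (a : ↥A),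
        φ (Submodule.Quotient.mk b) (Submodule.Quotient.mk a) = C (↑b) (↑a) := by
  let f : ↥A →ₗ[k] (↥B ⧸ (A ⊓ B).comap B.subtype) →ₗ[k] k :=
    { toFun := fun a => Submodule.liftQ _ ((C.flip a).comp B.subtype) (by
        intro b hb
        exact h1 b hb a a.2)
      map_add' := by
        intro x y
        apply Submodule.linearMap_qext
        ext b
        exact (C b).map_add x y
      map_smul' := by
        intro c x
        apply Submodule.linearMap_qext
        ext b
        exact (C b).map_smul c x }
  refine ⟨(Submodule.liftQ _ f ?_).flip, ?_⟩
  · intro a ha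
    rw [LinearMap.mem_ker]
    apply Submodule.linearMap_qext
    ext b
    exact h2 a ha b b.2
  · intro b a
    rfl

/-- if moreover `A/(A∩B)` is finite dimensional, the induced map
`B/(A∩B) → (A/(A∩B))^*` is an isomorphism; in particular the two quotients have the
same dimension. -/
theorem statement7 {k V : Type*} [Field k] [AddCommGroup V] [Module k V]
    (Bl : V →ₗ[k] V →ₗ[k] k)
    (A B : Submodule k V) (hA : gorth Bl A = A) (hB : gorth Bl B = B)
    (hfd : FiniteDimensional k (↥A ⧸ (A ⊓ B).comap A.subtype)) :
    (∃ φ : (↥B ⧸ (A ⊓ B).comap B.subtype) →ₗ[k]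
        Module.Dual k (↥A ⧸ (A ⊓ B).comap A.subtype),
      Function.Bijective φ ∧
      ∀ (b : ↥B) (a : ↥A),
        φ (Submodule.Quotient.mk b) (Submodule.Quotient.mk a) = Bl (↑a) (↑b)) ∧
    Module.finrank k (↥B ⧸ (A ⊓ B).comap B.subtype) =
      Module.finrank k (↥A ⧸ (A ⊓ B).comap A.subtype) := by
  have hA0 : ∀ x ∈ A, ∀ y ∈ A, Bl x y = 0 := fun x hx => by
    rw [← hA] at hx; exact hx
  have hB0 : ∀ x ∈ B, ∀ y ∈ B, Bl x y = 0 := fun x hx => by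
    rw [← hB] at hx; exact hx
  obtain ⟨φ, hφ⟩ := aux_pair Bl.flip A B (fun b hb a ha => hA0 a ha b hb.1)
    (fun a ha b hb => hB0 a ha.2 b hb)
  obtain ⟨ψ, hψ⟩ := aux_pair Bl A B (fun b hb a ha => hA0 b hb.1 a ha)
    (fun a ha b hb => hB0 b hb a ha.2)
  have iψ : Function.Injective ψ := by
    rw [injective_iff_map_eq_zero]
    intro x hx
    obtain ⟨b, rfl⟩ := Submodule.Quotient.mk_surjective _ x
    rw [Submodule.Quotient.mk_eq_zero]
    refine ⟨?_, b.2⟩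
    rw [← hA]
    intro a ha
    exact (hψ b ⟨a, ha⟩).symm.trans (by rw [hx]; rfl)
  have iφ : Function.Injective φ.flip := by
    rw [injective_iff_map_eq_zero]
    intro x hx
    obtain ⟨a, rfl⟩ := Submodule.Quotient.mk_surjective _ x
    rw [Submodule.Quotient.mk_eq_zero]
    refine ⟨a.2, ?_⟩
    rw [← hB]
    intro b hb
    refine (hφ ⟨b, hb⟩ a).symm.trans ?_
    rw [← LinearMap.flip_apply, hx]; rfl
  have fB : FiniteDimensional k (↥B ⧸ (A ⊓ B).comap B.subtype) :=
    FiniteDimensional.of_injective ψ iψ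
  have e1 := LinearMap.finrank_le_finrank_of_injective iψ
  have e2 := LinearMap.finrank_le_finrank_of_injective iφ
  rw [Subspace.dual_finrank_eq] at e1
  have e2' := e2.trans_eq Subspace.dual_finrank_eq
  have e := le_antisymm e1 e2'
  refine ⟨⟨φ, ?_, hφ⟩, e⟩
  rw [← LinearMap.flip_bijective_iff₁]
  refine ⟨iφ, (LinearMap.injective_iff_surjective_of_finrank_eq_finrank ?_).1 iφ⟩
  exact e.symm.trans Subspace.dual_finrank_eq.symm
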